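/- Let 1 < p < 2 and let f : ℝ → ℝ be continuous with primitive F(t) = ∫₀ᵗ f(τ)dτ. Assume there exists q > 2p/(2−p) such that t·f(t) ≥ q·F(t) ≥ 0 for all t ∈ ℝ. Then there exists s̄ ∈ (0,1) such that for every α ∈ (0,π) and every s ∈ (0,s̄), any classical solution u of div(|∇u|^{p−2}∇u) + f(u) = 0 on the domain Ω₂^{α,s} with zero boundary values is identically zero. -/

import Mathlib

open Real MeasureTheory

noncomputable section

/-- The gradient of a function `u : ℂ → ℝ`, where `ℂ` is identified with `ℝ²`:
the vector of the two partial derivatives. -/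
def grad (u : ℂ → ℝ) (z : ℂ) : ℂ := ⟨fderiv ℝ u z 1, fderiv ℝ u z Complex.I⟩

/-- The divergence of a vector field `A : ℂ → ℂ`, where `ℂ` is identified with `ℝ²`:
`div A = ∂₁A₁ + ∂₂A₂`. -/
def divg (A : ℂ → ℂ) (z : ℂ) : ℝ := (fderiv ℝ A z 1).re + (fderiv ℝ A z Complex.I).im

/-- The domain `Ω₂^{α,s} = {(ρ cos θ, ρ sin θ) : |θ| < α, |ρ - 1| < s} ⊆ ℝ² ≅ ℂ`. -/
def Omega2 (α s : ℝ) : Set ℂ :=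
  {z | ∃ ρ θ : ℝ, |θ| < α ∧ |ρ - 1| < s ∧ z = (ρ : ℂ) * Complex.exp (θ * Complex.I)}

/-- A classical solution of `div(|∇u|^{p-2}∇u) + f(u) = 0` on `Ω` with zero boundary values:
`u` is continuous on the closure of `Ω`, vanishes on the boundary of `Ω`, is continuously
differentiable on `Ω`, the field `A = ‖∇u‖^{p-2}∇u` (equal to `0` where `∇u = 0`, as the
real power `0 ^ (p-2)` is `0` for `p ≠ 2`) is continuously differentiable on `Ω` and satisfies
`div A + f(u) = 0` on `Ω`, and `‖∇u‖^p` is integrable on `Ω`. -/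
structure IsClassicalSolution (p : ℝ) (f : ℝ → ℝ) (Ω : Set ℂ) (u : ℂ → ℝ) : Prop where
  contOn : ContinuousOn u (closure Ω)
  boundary : ∀ z ∈ frontier Ω, u z = 0
  contDiffOn : ContDiffOn ℝ 1 u Ω
  fieldContDiffOn : ContDiffOn ℝ 1 (fun z => (‖grad u z‖ ^ (p - 2) : ℝ) • grad u z) Ω
  pde : ∀ z ∈ Ω, divg (fun w => (‖grad u w‖ ^ (p - 2) : ℝ) • grad u w) z + f (u z) = 0
  integrable : IntegrableOn (fun z => ‖grad u z‖ ^ p) Ω volume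

/-! ### Truncation -/

/-- Continuous cutoff: zero for `|t| ≤ ε`, one for `|t| ≥ 2ε`. -/
def chi (ε t : ℝ) : ℝ := max 0 (min 1 (|t| / ε - 1))

/-- Smooth truncation. -/
def trunc (ε t : ℝ) : ℝ := ∫ τ in (0:ℝ)..t, chi ε τ

lemma chi_cont (ε : ℝ) : Continuous (chi ε) := by
  unfold chi; fun_prop

lemma chi_nonneg (ε t : ℝ) : 0 ≤ chi ε t := le_max_left _ _

lemma chi_le_one (ε t : ℝ) : chi ε t ≤ 1 := max_le zero_le_one (min_le_left _ _)

lemma chi_eq_zero {ε t : ℝ} (hε : 0 < ε) (h : |t| ≤ ε) : chi ε t = 0 := by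
  unfold chi
  apply max_eq_left
  apply (min_le_right _ _).trans
  have : |t| / ε ≤ 1 := by rw [div_le_one hε]; exact h
  linarith

lemma chi_eq_one {ε t : ℝ} (hε : 0 < ε) (h : 2 * ε ≤ |t|) : chi ε t = 1 := by
  unfold chi
  have : 2 ≤ |t| / ε := by rw [le_div_iff₀ hε]; exact h
  rw [min_eq_left (by linarith)]
  simp

lemma trunc_hasDerivAt (ε t : ℝ) : HasDerivAt (trunc ε) (chi ε t) t :=
  intervalIntegral.integral_hasDerivAt_right ((chi_cont ε).intervalIntegrable _ _)
    ((chi_cont ε).stronglyMeasurableAtFilter _ _) (chi_cont ε).continuousAt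

lemma trunc_contDiff (ε : ℝ) : ContDiff ℝ 1 (trunc ε) := by
  rw [contDiff_one_iff_deriv]
  refine ⟨fun t => (trunc_hasDerivAt ε t).differentiableAt, ?_⟩
  have : deriv (trunc ε) = chi ε := funext fun t => (trunc_hasDerivAt ε t).deriv
  rw [this]; exact chi_cont ε

lemma abs_le_of_mem_uIoc {t τ : ℝ} (h : τ ∈ Set.uIoc 0 t) : |τ| ≤ |t| := by
  rcases le_total 0 t with ht | ht
  · rw [Set.uIoc_of_le ht] at h
    rw [abs_of_nonneg ht, abs_of_pos h.1]; exact h.2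
  · rw [Set.uIoc_of_ge ht] at h
    rw [abs_of_nonpos ht, abs_of_nonpos h.2]; linarith [h.1]

lemma trunc_eq_zero {ε t : ℝ} (hε : 0 < ε) (h : |t| ≤ ε) : trunc ε t = 0 := by
  unfold trunc
  apply intervalIntegral.integral_zero_ae
  refine Filter.Eventually.of_forall fun τ hτ => chi_eq_zero hε ((abs_le_of_mem_uIoc hτ).trans h)

lemma trunc_abs_le (ε t : ℝ) : |trunc ε t| ≤ |t| := by
  have := intervalIntegral.norm_integral_le_of_norm_le_const (a := 0) (b := t) (f := chi ε) (C := 1)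
    (fun x _ => by rw [Real.norm_eq_abs, abs_of_nonneg (chi_nonneg _ _)]; exact chi_le_one _ _)
  simpa [trunc] using this

lemma trunc_sub_le {ε : ℝ} (hε : 0 < ε) (t : ℝ) : |trunc ε t - t| ≤ 4 * ε := by
  have h1 : trunc ε t - t = ∫ τ in (0:ℝ)..t, (chi ε τ - 1) := by
    rw [intervalIntegral.integral_sub ((chi_cont ε).intervalIntegrable _ _) (by simp)]
    simp [trunc]
  rw [h1, ← Real.norm_eq_abs]
  refine (intervalIntegral.norm_integral_le_integral_norm_uIoc).trans ?_
  have hintg : IntegrableOn (fun τ => ‖chi ε τ - 1‖) (Set.uIoc 0 t) := by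
    have : Continuous fun τ => ‖chi ε τ - 1‖ := ((chi_cont ε).sub continuous_const).norm
    exact (this.integrableOn_uIcc).mono_set Set.uIoc_subset_uIcc
  have hind : Integrable ((Set.Icc (-(2 * ε)) (2 * ε)).indicator (fun _ => (1:ℝ))) := by
    rw [integrable_indicator_iff measurableSet_Icc]
    simp [integrableOn_const_iff]
  calc ∫ τ in Set.uIoc 0 t, ‖chi ε τ - 1‖
      ≤ ∫ τ in Set.uIoc 0 t, (Set.Icc (-(2 * ε)) (2 * ε)).indicator (fun _ => (1:ℝ)) τ := by
        apply integral_mono hintg hind.integrableOn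
        intro τ
        by_cases h : τ ∈ Set.Icc (-(2 * ε)) (2 * ε)
        · simp only [Set.indicator_of_mem h]
          rw [Real.norm_eq_abs, abs_le]
          constructor <;> linarith [chi_nonneg ε τ, chi_le_one ε τ]
        · simp only [Set.indicator_of_notMem h]
          have : 2 * ε ≤ |τ| := by
            by_contra hc
            push Not at hc
            exact h ⟨by linarith [(abs_lt.1 hc).1], (abs_lt.1 hc).2.le⟩
          rw [chi_eq_one hε this]; simp
    _ ≤ ∫ τ, (Set.Icc (-(2 * ε)) (2 * ε)).indicator (fun _ => (1:ℝ)) τ := by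
        apply setIntegral_le_integral hind
        refine Filter.Eventually.of_forall fun τ => Set.indicator_nonneg (fun _ _ => zero_le_one) _
    _ = 4 * ε := by
        rw [integral_indicator measurableSet_Icc]
        simp [Measure.real]
        rw [ENNReal.toReal_ofReal (by linarith)]
        ring

lemma trunc_tendsto (t : ℝ) :
    Filter.Tendsto (fun n : ℕ => trunc (1 / ((n:ℝ) + 1)) t) Filter.atTop (nhds t) := by
  have h := (tendsto_one_div_add_atTop_nhds_zero_nat (𝕜 := ℝ)).const_mul 4
  rw [mul_zero] at h
  rw [tendsto_iff_norm_sub_tendsto_zero]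
  refine squeeze_zero (fun _ => norm_nonneg _) (fun n => ?_) h
  exact trunc_sub_le (by positivity) t

/-! ### Integration by parts -/

lemma integrable_mul_of_tsupport {Q : Set ℂ} {h k : ℂ → ℝ} (hh : Continuous h)
    (hc : HasCompactSupport h) (hs : tsupport h ⊆ Q) (hk : ContinuousOn k Q) :
    Integrable (fun w => h w * k w) := by
  have h1 : IntegrableOn (fun w => h w * k w) (tsupport h) :=
    (hh.continuousOn.mul (hk.mono hs)).integrableOn_compact hc
  rwa [integrableOn_iff_integrable_of_support_subset] at h1
  intro w hw
  apply subset_tsupport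
  intro h0
  simp [h0] at hw

lemma weak_form {Q : Set ℂ} (hQ : IsOpen Q) {B : ℂ → ℂ} (hB : ContDiffOn ℝ 1 B Q)
    {Φ : ℂ → ℝ} (hΦ : ContDiff ℝ 1 Φ) (hc : HasCompactSupport Φ) (hs : tsupport Φ ⊆ Q) :
    Integrable (fun w => fderiv ℝ Φ w (B w)) ∧
    ∫ w, fderiv ℝ Φ w (B w) = - ∫ w, Φ w * divg B w := by
  have hdB : ∀ w ∈ Q, DifferentiableAt ℝ B w := fun w hw =>
    (hB.differentiableOn one_ne_zero).differentiableAt (hQ.mem_nhds hw)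
  have hfB : ContinuousOn (fderiv ℝ B) Q := hB.continuousOn_fderiv_of_isOpen hQ le_rfl
  have hfΦ : Continuous (fderiv ℝ Φ) := hΦ.continuous_fderiv one_ne_zero
  have hsf : ∀ v, tsupport (fun w => fderiv ℝ Φ w v) ⊆ tsupport Φ := fun v =>
    tsupport_fderiv_apply_subset ℝ v
  have hcf : ∀ v, HasCompactSupport (fun w => fderiv ℝ Φ w v) := fun v => hc.fderiv_apply ℝ v
  have key : ∀ (L : ℂ →L[ℝ] ℝ) (v : ℂ),
      Integrable (fun w => fderiv ℝ Φ w v * L (B w)) ∧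
      Integrable (fun w => Φ w * L (fderiv ℝ B w v)) ∧
      ∫ w, Φ w * L (fderiv ℝ B w v) = - ∫ w, fderiv ℝ Φ w v * L (B w) := by
    intro L v
    have hLB : ContinuousOn (fun w => L (B w)) Q := L.continuous.comp_continuousOn hB.continuousOn
    have hLfB : ContinuousOn (fun w => L (fderiv ℝ B w v)) Q :=
      L.continuous.comp_continuousOn (hfB.clm_apply continuousOn_const)
    have i1 := integrable_mul_of_tsupport (hfΦ.clm_apply continuous_const) (hcf v)
      ((hsf v).trans hs) hLB
    have i2 := integrable_mul_of_tsupport hΦ.continuous hc hs hLfB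
    have i3 := integrable_mul_of_tsupport hΦ.continuous hc hs hLB
    refine ⟨i1, i2, ?_⟩
    have := integral_bilinear_hasFDerivAt_right_eq_neg_left_of_integrable (μ := volume)
      (f := Φ) (f' := fderiv ℝ Φ) (g := fun w => L (B w)) (g' := fun w => L.comp (fderiv ℝ B w))
      (v := v) (B := ContinuousLinearMap.mul ℝ ℝ) (by simpa using i1) (by simpa using i2)
      (by simpa using i3) (fun x _ => (hΦ.differentiable one_ne_zero x).hasFDerivAt)
      (fun x hx => L.hasFDerivAt.comp x (hdB x (hs hx)).hasFDerivAt)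
    simpa using this
  obtain ⟨a1, a2, a3⟩ := key Complex.reCLM 1
  obtain ⟨b1, b2, b3⟩ := key Complex.imCLM Complex.I
  have e1 : ∀ w, fderiv ℝ Φ w (B w) = fderiv ℝ Φ w 1 * Complex.reCLM (B w)
      + fderiv ℝ Φ w Complex.I * Complex.imCLM (B w) := by
    intro w
    have : B w = (B w).re • (1:ℂ) + (B w).im • Complex.I := by
      simp [Complex.re_add_im]
    conv_lhs => rw [this, map_add, map_smul, map_smul]
    simp [mul_comm]
  have e2 : ∀ w, Φ w * divg B w = Φ w * Complex.reCLM (fderiv ℝ B w 1)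
      + Φ w * Complex.imCLM (fderiv ℝ B w Complex.I) := by
    intro w; simp [divg, mul_add]
  simp_rw [e1, e2]
  refine ⟨a1.add b1, ?_⟩
  rw [integral_add a1 b1, integral_add a2 b2, a3, b3]
  ring

/-! ### The problem in logarithmic coordinates -/

structure Setup (p δ R : ℝ) (f : ℝ → ℝ) (Q : Set ℂ) (U : ℂ → ℝ) (B : ℂ → ℂ) : Prop where
  hp1 : 1 < p
  hp2 : p < 2
  hδ : 0 ≤ δ
  hf : Continuous f
  Qopen : IsOpen Q
  Qconv : Convex ℝ Q
  Qzero : (0:ℂ) ∈ Q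
  Qbd : ∀ w ∈ Q, ‖w‖ ≤ R
  Qre : ∀ w ∈ Q, |w.re| ≤ δ
  Ucont : Continuous U
  Uzero : ∀ w, w ∉ Q → U w = 0
  Udiff : ContDiffOn ℝ 1 U Q
  Bdiff : ContDiffOn ℝ 1 B Q
  Bnorm : ∀ w ∈ Q, ‖B w‖ = exp ((2 - p) * w.re) * ‖fderiv ℝ U w‖ ^ (p - 1)
  Bapp : ∀ w ∈ Q, fderiv ℝ U w (B w) = exp ((2 - p) * w.re) * ‖fderiv ℝ U w‖ ^ p
  Bdiv : ∀ w ∈ Q, divg B w = - (exp (2 * w.re) * f (U w))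
  Eint : IntegrableOn (fun w => exp ((2 - p) * w.re) * ‖fderiv ℝ U w‖ ^ p) Q

/-- The energy. -/
def En (p : ℝ) (Q : Set ℂ) (U : ℂ → ℝ) : ℝ :=
  ∫ w in Q, exp ((2 - p) * w.re) * ‖fderiv ℝ U w‖ ^ p

namespace Setup

variable {p δ R : ℝ} {f : ℝ → ℝ} {Q : Set ℂ} {U : ℂ → ℝ} {B : ℂ → ℂ}

lemma Ucompact (S : Setup p δ R f Q U B) : HasCompactSupport U := by
  apply HasCompactSupport.of_support_subset_isCompact (isCompact_closedBall (0:ℂ) R)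
  intro w hw
  have : w ∈ Q := by
    by_contra h
    exact hw (S.Uzero w h)
  simpa using S.Qbd w this

lemma V_contDiff (S : Setup p δ R f Q U B) {ε : ℝ} (hε : 0 < ε) :
    ContDiff ℝ 1 (fun w => trunc ε (U w)) := by
  rw [contDiff_iff_contDiffAt]
  intro w
  by_cases hw : w ∈ Q
  · exact (trunc_contDiff ε).contDiffAt.comp w (S.Udiff.contDiffAt (S.Qopen.mem_nhds hw))
  · have h1 : ∀ᶠ y in nhds w, |U y| < ε := by
      have : Continuous fun y => |U y| := S.Ucont.abs
      apply this.continuousAt.eventually_lt continuousAt_const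
      simpa [S.Uzero w hw] using hε
    have h2 : (fun w => trunc ε (U w)) =ᶠ[nhds w] fun _ => 0 := by
      filter_upwards [h1] with y hy
      exact trunc_eq_zero hε hy.le
    exact contDiffAt_const.congr_of_eventuallyEq h2

lemma V_tsupport (S : Setup p δ R f Q U B) {ε : ℝ} (hε : 0 < ε) :
    tsupport (fun w => trunc ε (U w)) ⊆ Q := by
  have h1 : tsupport (fun w => trunc ε (U w)) ⊆ {w | ε ≤ |U w|} := by
    apply closure_minimal
    · intro w hw
      by_contra h
      simp only [Set.mem_ofPred_eq, not_le] at h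
      exact hw (trunc_eq_zero hε h.le)
    · exact isClosed_le continuous_const S.Ucont.abs
  intro w hw
  by_contra h
  have := h1 hw
  simp only [Set.mem_ofPred_eq, S.Uzero w h, abs_zero] at this
  linarith

lemma V_compact (S : Setup p δ R f Q U B) (ε : ℝ) :
    HasCompactSupport (fun w => trunc ε (U w)) :=
  S.Ucompact.comp_left (g := trunc ε) (by simp [trunc])

lemma Udiffat (S : Setup p δ R f Q U B) {w : ℂ} (hw : w ∈ Q) : DifferentiableAt ℝ U w :=
  (S.Udiff.differentiableOn one_ne_zero).differentiableAt (S.Qopen.mem_nhds hw)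

lemma V_fderiv (S : Setup p δ R f Q U B) (ε : ℝ) {w : ℂ} (hw : w ∈ Q) :
    fderiv ℝ (fun w => trunc ε (U w)) w = chi ε (U w) • fderiv ℝ U w :=
  ((trunc_hasDerivAt ε (U w)).comp_hasFDerivAt w (S.Udiffat hw).hasFDerivAt).fderiv

lemma fderiv_off {Φ : ℂ → ℝ} (hs : tsupport Φ ⊆ Q) {w : ℂ} (hw : w ∉ Q) :
    fderiv ℝ Φ w = 0 := by
  apply image_eq_zero_of_notMem_tsupport
  intro h
  exact hw (hs (tsupport_fderiv_subset ℝ h))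

lemma V_fderiv_norm (S : Setup p δ R f Q U B) {ε : ℝ} (hε : 0 < ε) (w : ℂ) :
    ‖fderiv ℝ (fun w => trunc ε (U w)) w‖ ≤ Q.indicator (fun w => ‖fderiv ℝ U w‖) w := by
  by_cases hw : w ∈ Q
  · rw [S.V_fderiv ε hw, Set.indicator_of_mem hw, norm_smul, Real.norm_eq_abs,
      abs_of_nonneg (chi_nonneg _ _)]
    exact mul_le_of_le_one_left (norm_nonneg _) (chi_le_one _ _)
  · rw [fderiv_off (S.V_tsupport hε) hw, Set.indicator_of_notMem hw]; simp

/-- dilation -/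
lemma dil_contDiff {Φ : ℂ → ℝ} (h : ContDiff ℝ 1 Φ) (r : ℝ) :
    ContDiff ℝ 1 (fun w => Φ (r • w)) := by
  exact h.comp (contDiff_const_smul r)

lemma mem_of_smul (S : Setup p δ R f Q U B) {r : ℝ} (hr : 1 ≤ r) {w : ℂ} (h : r • w ∈ Q) :
    w ∈ Q := by
  have h0 : 0 < r := by linarith
  have := S.Qconv.smul_mem_of_zero_mem S.Qzero h (t := r⁻¹)
    ⟨(inv_pos.2 h0).le, inv_le_one_of_one_le₀ hr⟩
  rwa [smul_smul, inv_mul_cancel₀ h0.ne', one_smul] at this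

lemma dil_tsupport (S : Setup p δ R f Q U B) {Φ : ℂ → ℝ} (hs : tsupport Φ ⊆ Q)
    {r : ℝ} (hr : 1 ≤ r) : tsupport (fun w => Φ (r • w)) ⊆ Q := by
  intro w hw
  have := tsupport_comp_subset_preimage Φ (continuous_const_smul r) hw
  exact S.mem_of_smul hr (hs this)

lemma dil_compact {Φ : ℂ → ℝ} (hc : HasCompactSupport Φ) {r : ℝ} (hr : 1 ≤ r) :
    HasCompactSupport (fun w => Φ (r • w)) := hc.comp_smul (by linarith)

lemma dil_fderiv {Φ : ℂ → ℝ} (r : ℝ) (w : ℂ) :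
    fderiv ℝ (fun w => Φ (r • w)) w = r • fderiv ℝ Φ (r • w) := by
  exact fderiv_comp_smul r

lemma weak (S : Setup p δ R f Q U B) {Φ : ℂ → ℝ} (hΦ : ContDiff ℝ 1 Φ)
    (hc : HasCompactSupport Φ) (hs : tsupport Φ ⊆ Q) :
    Integrable (fun w => fderiv ℝ Φ w (B w)) ∧
    ∫ w, fderiv ℝ Φ w (B w) = ∫ w, exp (2 * w.re) * f (U w) * Φ w := by
  obtain ⟨h1, h2⟩ := weak_form S.Qopen S.Bdiff hΦ hc hs
  refine ⟨h1, ?_⟩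
  rw [h2, ← integral_neg]
  congr 1
  ext w
  by_cases hw : w ∈ Q
  · rw [S.Bdiv w hw]; ring
  · have : Φ w = 0 := image_eq_zero_of_notMem_tsupport fun h => hw (hs h)
    simp [this]

lemma young {p a b : ℝ} (hp1 : 1 < p) (ha : 0 ≤ a) (hb : 0 ≤ b) :
    a * b ^ (p - 1) ≤ 1 / p * a ^ p + (1 - 1 / p) * b ^ p := by
  have hp0 : 0 < p := by linarith
  have hpq : p.HolderConjugate (p / (p - 1)) := Real.HolderConjugate.conjExponent hp1
  have h := Real.young_inequality_of_nonneg ha (Real.rpow_nonneg hb (p - 1)) hpq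
  rw [← Real.rpow_mul hb, mul_div_cancel₀ _ (by linarith : p - 1 ≠ 0)] at h
  calc _ ≤ _ := h
    _ = _ := by
      have : p - 1 ≠ 0 := by linarith
      field_simp

lemma Eint_ind (S : Setup p δ R f Q U B) : Integrable (Q.indicator
    (fun w => exp ((2 - p) * w.re) * ‖fderiv ℝ U w‖ ^ p)) :=
  S.Eint.integrable_indicator S.Qopen.measurableSet

lemma En_ind (S : Setup p δ R f Q U B) : ∫ w, Q.indicator
    (fun w => exp ((2 - p) * w.re) * ‖fderiv ℝ U w‖ ^ p) w = En p Q U :=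
  integral_indicator S.Qopen.measurableSet

lemma En_nonneg : 0 ≤ En p Q U := integral_nonneg fun w => by positivity

lemma exp_re_cont (c : ℝ) : Continuous fun w : ℂ => exp (c * w.re) := by fun_prop

/-- Young's inequality step. -/
lemma young_step (S : Setup p δ R f Q U B) {Φ : ℂ → ℝ} (hΦ : ContDiff ℝ 1 Φ)
    (hc : HasCompactSupport Φ) (hs : tsupport Φ ⊆ Q) :
    ∫ w, exp (2 * w.re) * f (U w) * Φ w ≤
      1 / p * (∫ w, exp ((2 - p) * w.re) * ‖fderiv ℝ Φ w‖ ^ p) + (1 - 1 / p) * En p Q U := by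
  obtain ⟨h1, h2⟩ := S.weak hΦ hc hs
  have hp0 : 0 < p := by linarith [S.hp1]
  have hfΦ : Continuous (fderiv ℝ Φ) := hΦ.continuous_fderiv one_ne_zero
  have i1 : Integrable (fun w => exp ((2 - p) * w.re) * ‖fderiv ℝ Φ w‖ ^ p) := by
    apply Continuous.integrable_of_hasCompactSupport
    · exact (exp_re_cont _).mul (hfΦ.norm.rpow_const fun _ => Or.inr hp0.le)
    · have := hc.fderiv (𝕜 := ℝ)
      apply HasCompactSupport.mul_left
      exact this.comp_left (g := fun L => ‖L‖ ^ p) (by simp [hp0.ne'])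
  rw [← h2, ← S.En_ind, ← integral_const_mul, ← integral_const_mul,
    ← integral_add (i1.const_mul _) (S.Eint_ind.const_mul _)]
  apply integral_mono h1 ((i1.const_mul _).add (S.Eint_ind.const_mul _))
  intro w
  by_cases hw : w ∈ Q
  · simp only [Pi.add_apply, Set.indicator_of_mem hw]
    calc fderiv ℝ Φ w (B w) ≤ ‖fderiv ℝ Φ w‖ * ‖B w‖ :=
          (le_abs_self _).trans ((fderiv ℝ Φ w).le_opNorm _)
      _ = exp ((2 - p) * w.re) * (‖fderiv ℝ Φ w‖ * ‖fderiv ℝ U w‖ ^ (p - 1)) := by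
          rw [S.Bnorm w hw]; ring
      _ ≤ exp ((2 - p) * w.re) * (1 / p * ‖fderiv ℝ Φ w‖ ^ p
            + (1 - 1 / p) * ‖fderiv ℝ U w‖ ^ p) := by
          gcongr
          exact young S.hp1 (norm_nonneg _) (norm_nonneg _)
      _ = _ := by ring
  · simp only [Pi.add_apply, Set.indicator_of_notMem hw, fderiv_off hs hw]
    simp [hp0.ne']

lemma one_sub_exp_neg (τ : ℝ) : 1 - exp (-τ) ≤ τ := by
  linarith [Real.add_one_le_exp (-τ)]

/-- The dilated energy. -/
lemma dil_energy (S : Setup p δ R f Q U B) {ε : ℝ} (hε : 0 < ε) {τ : ℝ} (hτ : 0 ≤ τ) :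
    ∫ w, exp ((2 - p) * w.re) * ‖fderiv ℝ (fun w => trunc ε (U (exp τ • w))) w‖ ^ p
      ≤ exp (-((2 - p) * (1 - δ) * τ)) * En p Q U := by
  have hp0 : 0 < p := by linarith [S.hp1]
  set H : ℂ → ℝ := fun y => exp ((2 - p) * (exp (-τ) * y.re)) *
    ‖fderiv ℝ (fun w => trunc ε (U w)) y‖ ^ p with hH
  have e1 : ∀ w, exp ((2 - p) * w.re) * ‖fderiv ℝ (fun w => trunc ε (U (exp τ • w))) w‖ ^ p
      = exp (p * τ) * H (exp τ • w) := by
    intro w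
    have := dil_fderiv (Φ := fun w => trunc ε (U w)) (exp τ) w
    rw [this, norm_smul, Real.norm_eq_abs, Real.abs_exp,
      Real.mul_rpow (exp_pos _).le (norm_nonneg _), ← Real.exp_mul]
    simp only [hH, Complex.smul_re, smul_eq_mul]
    rw [← mul_assoc (exp (-τ)), ← Real.exp_add]
    simp only [neg_add_cancel, Real.exp_zero, one_mul]
    ring_nf
  simp_rw [e1]
  rw [integral_const_mul, Measure.integral_comp_smul, Complex.finrank_real_complex]
  have e2 : |(exp τ ^ 2)⁻¹| = exp (-2 * τ) := by
    rw [abs_of_pos (by positivity), ← Real.exp_nat_mul, ← Real.exp_neg]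
    push_cast; ring_nf
  rw [e2, smul_eq_mul]
  have hle : ∫ y, H y ≤ exp ((2 - p) * δ * τ) * En p Q U := by
    rw [← S.En_ind, ← integral_const_mul]
    apply integral_mono_of_nonneg
    · exact Filter.Eventually.of_forall fun y => by simp only [hH, Pi.zero_apply]; positivity
    · exact S.Eint_ind.const_mul _
    refine Filter.Eventually.of_forall fun y => ?_
    have hn := S.V_fderiv_norm hε y
    by_cases hy : y ∈ Q
    · simp only [Set.indicator_of_mem hy, hH] at hn ⊢
      rw [← mul_assoc (exp ((2 - p) * δ * τ)), ← Real.exp_add]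
      have h2p : 0 < 2 - p := by linarith [S.hp2]
      have : (2 - p) * (exp (-τ) * y.re) ≤ (2 - p) * δ * τ + (2 - p) * y.re := by
        have hre := abs_le.1 (S.Qre y hy)
        have k1 := one_sub_exp_neg τ
        have k2 : 0 ≤ 1 - exp (-τ) := by
          have : exp (-τ) ≤ 1 := Real.exp_le_one_iff.2 (by linarith)
          linarith
        have k3 : (1 - exp (-τ)) * (-y.re) ≤ τ * δ :=
          (mul_le_mul_of_nonneg_left (by linarith [hre.1]) k2).trans
            (mul_le_mul_of_nonneg_right k1 S.hδ)
        nlinarith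
      gcongr
    · simp only [Set.indicator_of_notMem hy, hH] at hn ⊢
      have : ‖fderiv ℝ (fun w => trunc ε (U w)) y‖ = 0 := le_antisymm hn (norm_nonneg _)
      simp [this, hp0.ne']
  calc _ ≤ exp (p * τ) * (exp (-2 * τ) * (exp ((2 - p) * δ * τ) * En p Q U)) := by gcongr
    _ = _ := by
      rw [← mul_assoc, ← mul_assoc, ← Real.exp_add, ← Real.exp_add]
      ring_nf

end Setup

namespace Setup

variable {p δ R : ℝ} {f : ℝ → ℝ} {Q : Set ℂ} {U : ℂ → ℝ} {B : ℂ → ℂ}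

lemma weight_integrable (S : Setup p δ R f Q U B) {g : ℂ → ℝ} (hg : Continuous g)
    (hc : HasCompactSupport g) : Integrable (fun w => exp (2 * w.re) * f (U w) * g w) := by
  apply Continuous.integrable_of_hasCompactSupport
  · exact ((exp_re_cont 2).mul (S.hf.comp S.Ucont)).mul hg
  · exact hc.mul_left

lemma trunc_limit (S : Setup p δ R f Q U B) {g : ℂ → ℝ} (hg : Continuous g)
    (hc : HasCompactSupport g) :
    Filter.Tendsto (fun n : ℕ => ∫ w, exp (2 * w.re) * f (U w) * trunc (1 / ((n:ℝ) + 1)) (g w))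
      Filter.atTop (nhds (∫ w, exp (2 * w.re) * f (U w) * g w)) := by
  apply tendsto_integral_of_dominated_convergence
    (fun w => ‖exp (2 * w.re) * f (U w) * g w‖)
  · intro n
    exact (((exp_re_cont 2).mul (S.hf.comp S.Ucont)).mul
      ((trunc_contDiff _).continuous.comp hg)).aestronglyMeasurable
  · exact (S.weight_integrable hg hc).norm
  · intro n
    refine Filter.Eventually.of_forall fun w => ?_
    rw [norm_mul, norm_mul _ (g w)]
    gcongr
    exact trunc_abs_le _ _
  · exact Filter.Eventually.of_forall fun w => (trunc_tendsto (g w)).const_mul _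

lemma Udil_cont (S : Setup p δ R f Q U B) (r : ℝ) : Continuous fun w => U (r • w) :=
  S.Ucont.comp (continuous_const_smul r)

lemma one_le_exp' {τ : ℝ} (hτ : 0 ≤ τ) : 1 ≤ exp τ := Real.one_le_exp hτ

lemma test_dil (S : Setup p δ R f Q U B) {τ : ℝ} (hτ : 0 ≤ τ) :
    ∫ w, exp (2 * w.re) * f (U w) * U (exp τ • w) ≤
      1 / p * (exp (-((2 - p) * (1 - δ) * τ)) * En p Q U) + (1 - 1 / p) * En p Q U := by
  have hp0 : 0 < p := by linarith [S.hp1]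
  have h1 := S.trunc_limit (S.Udil_cont (exp τ)) (dil_compact S.Ucompact (one_le_exp' hτ))
  refine le_of_tendsto' h1 fun n => ?_
  have hε : 0 < 1 / ((n:ℝ) + 1) := by positivity
  have h2 := S.young_step (dil_contDiff (S.V_contDiff hε) (exp τ))
    (dil_compact (S.V_compact _) (one_le_exp' hτ))
    (S.dil_tsupport (S.V_tsupport hε) (one_le_exp' hτ))
  refine h2.trans ?_
  have h3 := S.dil_energy hε hτ
  gcongr

lemma null (S : Setup p δ R f Q U B) :
    ∀ᵐ w : ℂ, w ∈ Q → U w = 0 → fderiv ℝ U w = 0 := by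
  set s : Set ℂ := Q ∩ {w | U w = 0} with hs
  have hsm : MeasurableSet s := S.Qopen.measurableSet.inter
    (isClosed_eq S.Ucont continuous_const).measurableSet
  have happ : ApproximatesLinearOn (fun w => (U w : ℂ)) (0 : ℂ →L[ℝ] ℂ) s 0 := by
    intro x hx y hy
    have h1 : U x = 0 := hx.2
    have h2 : U y = 0 := hy.2
    simp [h1, h2]
  have := happ.norm_fderiv_sub_le volume hsm
    (fun w => Complex.ofRealCLM.comp (fderiv ℝ U w))
    (fun x hx => (Complex.ofRealCLM.hasFDerivAt.comp x
      (S.Udiffat hx.1).hasFDerivAt).hasFDerivWithinAt)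
  rw [ae_restrict_iff' hsm] at this
  filter_upwards [this] with w hw hwQ hU
  have h0 := hw ⟨hwQ, hU⟩
  rw [sub_zero, nonpos_iff_eq_zero, nnnorm_eq_zero] at h0
  ext v
  have := congrArg (fun L => L v) h0
  simpa using this

lemma chi_limit {t : ℝ} (ht : t ≠ 0) :
    Filter.Tendsto (fun n : ℕ => chi (1 / ((n:ℝ) + 1)) t) Filter.atTop (nhds 1) := by
  have h := (tendsto_one_div_add_atTop_nhds_zero_nat (𝕜 := ℝ)).const_mul 2
  rw [mul_zero] at h
  have h2 : ∀ᶠ n : ℕ in Filter.atTop, 2 * (1 / ((n:ℝ) + 1)) < |t| :=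
    h.eventually_lt_const (abs_pos.2 ht)
  apply tendsto_const_nhds.congr'
  filter_upwards [h2] with n hn
  exact (chi_eq_one (by positivity) hn.le).symm

lemma energy_eq (S : Setup p δ R f Q U B) :
    En p Q U = ∫ w, exp (2 * w.re) * f (U w) * U w := by
  have hp0 : 0 < p := by linarith [S.hp1]
  have h1 := S.trunc_limit S.Ucont S.Ucompact
  have h2 : Filter.Tendsto (fun n : ℕ => ∫ w, Q.indicator (fun w => chi (1 / ((n:ℝ) + 1)) (U w) *
      (exp ((2 - p) * w.re) * ‖fderiv ℝ U w‖ ^ p)) w) Filter.atTop (nhds (En p Q U)) := by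
    rw [← S.En_ind]
    apply tendsto_integral_of_dominated_convergence
      (Q.indicator (fun w => exp ((2 - p) * w.re) * ‖fderiv ℝ U w‖ ^ p))
    · intro n
      have : Q.indicator (fun w => chi (1 / ((n:ℝ) + 1)) (U w) *
          (exp ((2 - p) * w.re) * ‖fderiv ℝ U w‖ ^ p)) = fun w => chi (1 / ((n:ℝ) + 1)) (U w) *
          Q.indicator (fun w => (exp ((2 - p) * w.re) * ‖fderiv ℝ U w‖ ^ p)) w := by
        ext w
        by_cases hw : w ∈ Q <;> simp [hw]
      rw [this]
      exact ((chi_cont _).comp S.Ucont).aestronglyMeasurable.mul S.Eint_ind.aestronglyMeasurable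
    · exact S.Eint_ind
    · intro n
      refine Filter.Eventually.of_forall fun w => ?_
      by_cases hw : w ∈ Q
      · simp only [Set.indicator_of_mem hw]
        have : 0 ≤ exp ((2 - p) * w.re) * ‖fderiv ℝ U w‖ ^ p := by positivity
        rw [Real.norm_eq_abs, abs_of_nonneg (mul_nonneg (chi_nonneg _ _) this)]
        exact mul_le_of_le_one_left this (chi_le_one _ _)
      · simp [hw]
    · filter_upwards [S.null] with w hnull
      by_cases hw : w ∈ Q
      · simp only [Set.indicator_of_mem hw]
        by_cases hU : U w = 0
        · simp [hnull hw hU, hp0.ne']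
        · simpa using (chi_limit hU).mul_const (exp ((2 - p) * w.re) * ‖fderiv ℝ U w‖ ^ p)
      · simp [hw]
  refine tendsto_nhds_unique h2 (h1.congr fun n => ?_)
  have hε : 0 < 1 / ((n:ℝ) + 1) := by positivity
  rw [← (S.weak (S.V_contDiff hε) (S.V_compact _) (S.V_tsupport hε)).2]
  congr 1
  ext w
  by_cases hw : w ∈ Q
  · simp only [Set.indicator_of_mem hw]
    rw [S.V_fderiv _ hw, smul_apply, S.Bapp w hw, smul_eq_mul]
  · rw [fderiv_off (S.V_tsupport hε) hw]
    simp [hw]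

lemma dil_L1 {v : ℂ → ℝ} (hv : ContDiff ℝ 1 v) (hc : HasCompactSupport v) {τ : ℝ} (hτ : 0 ≤ τ) :
    ∫ w, |v (exp τ • w) - v w| ≤ τ * ∫ y, ‖fderiv ℝ v y‖ * ‖y‖ := by
  set k : ℂ → ℝ := fun y => ‖fderiv ℝ v y‖ * ‖y‖ with hk
  have hfv : Continuous (fderiv ℝ v) := hv.continuous_fderiv one_ne_zero
  have hkc : Continuous k := hfv.norm.mul continuous_norm
  have hkn : ∀ y, 0 ≤ k y := fun y => by positivity
  have hks : HasCompactSupport k := ((hc.fderiv (𝕜 := ℝ)).norm).mul_right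
  have hki : Integrable k := hkc.integrable_of_hasCompactSupport hks
  have hpt : ∀ w, ‖v (exp τ • w) - v w‖ₑ ≤ ∫⁻ t in Set.Ioc 0 τ, ‖k (exp t • w)‖ₑ := by
    intro w
    have hd : ∀ t : ℝ, HasDerivAt (fun t => v (exp t • w))
        (fderiv ℝ v (exp t • w) (exp t • w)) t := by
      intro t
      have h1 : HasDerivAt (fun t => exp t • w) (exp t • w) t :=
        (Real.hasDerivAt_exp t).smul_const w
      exact ((hv.differentiable one_ne_zero (exp t • w)).hasFDerivAt).comp_hasDerivAt t h1
    have hcw : Continuous fun t : ℝ => exp t • w := by fun_prop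
    have hci : Continuous fun t : ℝ => fderiv ℝ v (exp t • w) (exp t • w) :=
      (hfv.comp hcw).clm_apply hcw
    have hftc := intervalIntegral.integral_eq_sub_of_hasDerivAt (a := 0) (b := τ)
      (fun t _ => hd t) (hci.intervalIntegrable _ _)
    simp only [Real.exp_zero, one_smul] at hftc
    rw [← hftc, intervalIntegral.integral_of_le hτ]
    refine (enorm_integral_le_lintegral_enorm _).trans ?_
    apply lintegral_mono
    intro t
    apply enorm_le_iff_norm_le.2
    rw [Real.norm_eq_abs (k _), abs_of_nonneg (hkn _)]
    exact (fderiv ℝ v (exp t • w)).le_opNorm _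
  have hmeas : Measurable (Function.uncurry fun (w : ℂ) (t : ℝ) => ‖k (exp t • w)‖ₑ) := by
    have : Continuous fun x : ℂ × ℝ => k (exp x.2 • x.1) := hkc.comp (by fun_prop)
    exact this.measurable.enorm
  have hinner : ∀ t ∈ Set.Ioc 0 τ, ∫⁻ w, ‖k (exp t • w)‖ₑ ≤ ENNReal.ofReal (∫ y, k y) := by
    intro t ht
    have hit : Integrable fun w => k (exp t • w) := hki.comp_smul (exp_pos t).ne'
    rw [← ofReal_integral_norm_eq_lintegral_enorm hit]
    apply ENNReal.ofReal_le_ofReal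
    have : ∀ w, ‖k (exp t • w)‖ = k (exp t • w) := fun w => by
      rw [Real.norm_eq_abs, abs_of_nonneg (hkn _)]
    simp_rw [this]
    rw [Measure.integral_comp_smul, smul_eq_mul, Complex.finrank_real_complex]
    apply mul_le_of_le_one_left (integral_nonneg hkn)
    rw [abs_of_pos (by positivity)]
    apply inv_le_one_of_one_le₀
    exact one_le_pow₀ (Real.one_le_exp ht.1.le)
  have hmain : ∫⁻ w, ‖v (exp τ • w) - v w‖ₑ ≤ ENNReal.ofReal (τ * ∫ y, k y) := by
    calc ∫⁻ w, ‖v (exp τ • w) - v w‖ₑ ≤ ∫⁻ w, ∫⁻ t in Set.Ioc 0 τ, ‖k (exp t • w)‖ₑ :=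
          lintegral_mono hpt
      _ = ∫⁻ t in Set.Ioc 0 τ, ∫⁻ w, ‖k (exp t • w)‖ₑ :=
          lintegral_lintegral_swap hmeas.aemeasurable
      _ ≤ ∫⁻ t in Set.Ioc 0 τ, ENNReal.ofReal (∫ y, k y) :=
          setLIntegral_mono measurable_const hinner
      _ = ENNReal.ofReal (τ * ∫ y, k y) := by
          rw [lintegral_const, Measure.restrict_apply_univ, Real.volume_Ioc, sub_zero,
            ← ENNReal.ofReal_mul (integral_nonneg hkn), mul_comm]
  have hintg : Integrable fun w => v (exp τ • w) - v w :=
    ((hv.continuous.integrable_of_hasCompactSupport hc).comp_smul (exp_pos τ).ne').sub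
      (hv.continuous.integrable_of_hasCompactSupport hc)
  rw [← ofReal_integral_norm_eq_lintegral_enorm hintg] at hmain
  exact (ENNReal.ofReal_le_ofReal_iff (mul_nonneg hτ (integral_nonneg hkn))).1 hmain

lemma D_integrable (S : Setup p δ R f Q U B) :
    Integrable (Q.indicator (fun w => ‖fderiv ℝ U w‖)) := by
  have hp0 : 0 < p := by linarith [S.hp1]
  rw [integrable_indicator_iff S.Qopen.measurableSet]
  have hfin : volume Q < ⊤ := by
    refine lt_of_le_of_lt (measure_mono (t := Metric.closedBall (0:ℂ) R) ?_)
      measure_closedBall_lt_top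
    intro w hw
    simpa using S.Qbd w hw
  have h1 : IntegrableOn (fun _ : ℂ => (1:ℝ)) Q := by
    rw [integrableOn_const_iff]; exact Or.inr hfin
  have h2 := h1.add (S.Eint.const_mul (exp ((2 - p) * δ)))
  refine h2.mono' ?_ ?_
  · exact ((S.Udiff.continuousOn_fderiv_of_isOpen S.Qopen le_rfl).norm).aestronglyMeasurable
      S.Qopen.measurableSet
  · rw [ae_restrict_iff' S.Qopen.measurableSet]
    refine Filter.Eventually.of_forall fun w hw => ?_
    rw [norm_norm]
    simp only [Pi.add_apply]
    have h3 : 1 ≤ exp ((2 - p) * δ) * exp ((2 - p) * w.re) := by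
      rw [← Real.exp_add]
      apply Real.one_le_exp
      have := (abs_le.1 (S.Qre w hw)).1
      nlinarith [S.hp2]
    have h4 : ‖fderiv ℝ U w‖ ≤ 1 + ‖fderiv ℝ U w‖ ^ p := by
      rcases le_total ‖fderiv ℝ U w‖ 1 with h | h
      · have : 0 ≤ ‖fderiv ℝ U w‖ ^ p := by positivity
        linarith
      · have := Real.self_le_rpow_of_one_le h S.hp1.le
        linarith
    have h5 : 0 ≤ ‖fderiv ℝ U w‖ ^ p := by positivity
    rw [← mul_assoc]
    nlinarith

lemma U_L1 (S : Setup p δ R f Q U B) : ∃ C : ℝ, 0 ≤ C ∧ ∀ τ : ℝ, 0 ≤ τ →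
    ∫ w, |U (exp τ • w) - U w| ≤ C * τ := by
  have hR : 0 ≤ R := (norm_nonneg _).trans (S.Qbd 0 S.Qzero)
  have hnn : ∀ w, 0 ≤ Q.indicator (fun w => ‖fderiv ℝ U w‖) w :=
    fun w => Set.indicator_nonneg (fun _ _ => norm_nonneg _) w
  refine ⟨R * ∫ w, Q.indicator (fun w => ‖fderiv ℝ U w‖) w,
    mul_nonneg hR (integral_nonneg hnn), fun τ hτ => ?_⟩
  have hUi : Integrable U := S.Ucont.integrable_of_hasCompactSupport S.Ucompact
  have hlim : Filter.Tendsto (fun n : ℕ => ∫ w, |trunc (1 / ((n:ℝ) + 1)) (U (exp τ • w))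
      - trunc (1 / ((n:ℝ) + 1)) (U w)|) Filter.atTop (nhds (∫ w, |U (exp τ • w) - U w|)) := by
    apply tendsto_integral_of_dominated_convergence (fun w => |U (exp τ • w)| + |U w|)
    · intro n
      exact ((((trunc_contDiff _).continuous.comp (S.Udil_cont (exp τ))).sub
        ((trunc_contDiff _).continuous.comp S.Ucont)).abs).aestronglyMeasurable
    · exact (hUi.comp_smul (exp_pos τ).ne').abs.add hUi.abs
    · intro n
      refine Filter.Eventually.of_forall fun w => ?_
      rw [Real.norm_eq_abs, abs_abs]
      exact (abs_sub _ _).trans (add_le_add (trunc_abs_le _ _) (trunc_abs_le _ _))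
    · exact Filter.Eventually.of_forall fun w =>
        ((trunc_tendsto _).sub (trunc_tendsto _)).abs
  refine le_of_tendsto' hlim fun n => ?_
  have hε : 0 < 1 / ((n:ℝ) + 1) := by positivity
  refine (dil_L1 (S.V_contDiff hε) (S.V_compact _) hτ).trans ?_
  rw [mul_comm]
  gcongr
  rw [← integral_const_mul]
  apply integral_mono_of_nonneg
  · exact Filter.Eventually.of_forall fun y => by simp only [Pi.zero_apply]; positivity
  · exact S.D_integrable.const_mul _
  refine Filter.Eventually.of_forall fun y => ?_
  have hn := S.V_fderiv_norm hε y
  by_cases hy : y ∈ Q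
  · have := S.Qbd y hy
    simp only
    rw [mul_comm R]
    exact mul_le_mul hn this (norm_nonneg _) (hnn y)
  · simp only
    rw [fderiv_off (S.V_tsupport hε) hy]
    simp [hy]

end Setup

namespace Setup

variable {p δ R : ℝ} {f : ℝ → ℝ} {Q : Set ℂ} {U : ℂ → ℝ} {B : ℂ → ℂ}

lemma F_integrable {F : ℝ → ℝ} (hF : Continuous F) (hF0 : F 0 = 0) {g : ℂ → ℝ}
    (hg : Continuous g) (hc : HasCompactSupport g) (c : ℝ) :
    Integrable (fun w => exp (c * w.re) * F (g w)) := by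
  apply Continuous.integrable_of_hasCompactSupport
  · exact (exp_re_cont c).mul (hF.comp hg)
  · exact (hc.comp_left (g := F) hF0).mul_left

lemma F_dil (S : Setup p δ R f Q U B) {F : ℝ → ℝ} (hF : Continuous F) (hF0 : F 0 = 0)
    (hFn : ∀ t, 0 ≤ F t) {τ : ℝ} (hτ : 0 ≤ τ) :
    exp (-(2 * (1 + δ) * τ)) * ∫ w, exp (2 * w.re) * F (U w) ≤
      ∫ w, exp (2 * w.re) * F (U (exp τ • w)) := by
  set H : ℂ → ℝ := fun y => exp ((2 * exp (-τ)) * y.re) * F (U y) with hH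
  have e1 : ∀ w, exp (2 * w.re) * F (U (exp τ • w)) = H (exp τ • w) := by
    intro w
    simp only [hH, Complex.smul_re, smul_eq_mul]
    have : 2 * exp (-τ) * (exp τ * w.re) = 2 * (exp (-τ) * exp τ) * w.re := by ring
    rw [this, ← Real.exp_add]
    simp
  simp_rw [e1]
  rw [Measure.integral_comp_smul, Complex.finrank_real_complex]
  have e2 : |(exp τ ^ 2)⁻¹| = exp (-2 * τ) := by
    rw [abs_of_pos (by positivity), ← Real.exp_nat_mul, ← Real.exp_neg]
    push_cast; ring_nf
  rw [e2, smul_eq_mul]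
  have hle : exp (-(2 * δ * τ)) * ∫ w, exp (2 * w.re) * F (U w) ≤ ∫ y, H y := by
    rw [← integral_const_mul]
    apply integral_mono ((F_integrable hF hF0 S.Ucont S.Ucompact 2).const_mul _)
      (F_integrable hF hF0 S.Ucont S.Ucompact _)
    intro y
    by_cases hy : y ∈ Q
    · simp only
      rw [← mul_assoc, ← Real.exp_add]
      have hre := abs_le.1 (S.Qre y hy)
      have k1 := one_sub_exp_neg τ
      have k2 : 0 ≤ 1 - exp (-τ) := by
        have : exp (-τ) ≤ 1 := Real.exp_le_one_iff.2 (by linarith)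
        linarith
      have k3 : (1 - exp (-τ)) * y.re ≤ τ * δ :=
        (mul_le_mul_of_nonneg_left (by linarith [hre.2]) k2).trans
          (mul_le_mul_of_nonneg_right k1 S.hδ)
      apply mul_le_mul_of_nonneg_right _ (hFn _)
      apply Real.exp_le_exp.2
      nlinarith
    · simp [S.Uzero y hy, hF0]
  calc _ = exp (-2 * τ) * (exp (-(2 * δ * τ)) * ∫ w, exp (2 * w.re) * F (U w)) := by
        rw [← mul_assoc, ← Real.exp_add]; ring_nf
    _ ≤ _ := by gcongr

lemma taylor {F : ℝ → ℝ} (hF : ∀ t, HasDerivAt F (f t) t) {a b η : ℝ}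
    (h : ∀ ξ ∈ Set.uIcc a b, |f ξ - f a| ≤ η) :
    F b - F a - η * |b - a| ≤ f a * (b - a) := by
  have := (convex_uIcc a b).norm_image_sub_le_of_norm_hasDerivWithin_le
    (f := fun x => F x - f a * x) (f' := fun x => f x - f a) (C := η)
    (fun x _ => by
      have := (hF x).sub ((hasDerivAt_id x).const_mul (f a))
      rw [mul_one] at this
      exact this.hasDerivWithinAt)
    (fun x hx => h x hx) Set.left_mem_uIcc Set.right_mem_uIcc
  rw [Real.norm_eq_abs, Real.norm_eq_abs] at this
  have := (abs_le.1 this).2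
  linarith

lemma uniform (S : Setup p δ R f Q U B) {η : ℝ} (hη : 0 < η) :
    ∀ᶠ τ in nhdsWithin (0:ℝ) (Set.Ioi 0), ∀ w ∈ Q,
      ∀ ξ ∈ Set.uIcc (U w) (U (exp τ • w)), |f ξ - f (U w)| ≤ η := by
  obtain ⟨M, hM⟩ := S.Ucompact.exists_bound_of_continuous S.Ucont
  have hfu : UniformContinuousOn f (Set.Icc (-M) M) :=
    isCompact_Icc.uniformContinuousOn_of_continuous S.hf.continuousOn
  obtain ⟨d, hd, hfd⟩ := Metric.uniformContinuousOn_iff.1 hfu η hη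
  have hUu : UniformContinuous U := S.Ucompact.uniformContinuous_of_continuous S.Ucont
  obtain ⟨d1, hd1, hUd⟩ := Metric.uniformContinuous_iff.1 hUu d hd
  have hc : Continuous fun τ : ℝ => |exp τ - 1| * R := by fun_prop
  have h1 : ∀ᶠ τ in nhds (0:ℝ), |exp τ - 1| * R < d1 := by
    apply hc.continuousAt.eventually_lt continuousAt_const
    simpa using hd1
  filter_upwards [nhdsWithin_le_nhds h1] with τ hτ w hw ξ hξ
  have hM' : ∀ w, U w ∈ Set.Icc (-M) M := fun w => by
    have := hM w
    rw [Real.norm_eq_abs, abs_le] at this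
    exact this
  have h2 : dist (exp τ • w) w < d1 := by
    have : exp τ • w - w = (exp τ - 1) • w := by rw [sub_smul, one_smul]
    rw [dist_eq_norm, this, norm_smul, Real.norm_eq_abs]
    exact lt_of_le_of_lt (mul_le_mul_of_nonneg_left (S.Qbd w hw) (abs_nonneg _)) hτ
  have h3 := hUd h2
  rw [Real.dist_eq] at h3
  have h4 : |ξ - U w| ≤ |U (exp τ • w) - U w| := Set.abs_sub_left_of_mem_uIcc hξ
  have h5 := hfd ξ (Set.uIcc_subset_Icc (hM' _) (hM' _) hξ) (U w) (hM' w)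
    (by rw [Real.dist_eq]; exact h4.trans_lt h3)
  rw [Real.dist_eq] at h5
  exact h5.le

lemma energy_zero (S : Setup p δ R f Q U B) {F : ℝ → ℝ} (hF : ∀ t, HasDerivAt F (f t) t)
    (hF0 : F 0 = 0) (hFn : ∀ t, 0 ≤ F t) {q : ℝ} (hq : 0 < q) (hqF : ∀ t, q * F t ≤ t * f t)
    (hcon : 2 * (1 + δ) / q < (2 - p) * (1 - δ) / p) : En p Q U = 0 := by
  have hp0 : 0 < p := by linarith [S.hp1]
  have hFc : Continuous F := continuous_iff_continuousAt.2 fun t => (hF t).continuousAt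
  set E := En p Q U with hE
  have hE0 : 0 ≤ E := En_nonneg
  set I := ∫ w, exp (2 * w.re) * F (U w) with hI
  have hI0 : 0 ≤ I := integral_nonneg fun w => mul_nonneg (exp_pos _).le (hFn _)
  have iF := F_integrable hFc hF0 S.Ucont S.Ucompact 2
  have ifU := S.weight_integrable S.Ucont S.Ucompact
  have hqI : q * I ≤ E := by
    rw [hE, S.energy_eq, hI, ← integral_const_mul]
    apply integral_mono (iF.const_mul q) ifU
    intro w
    have := mul_le_mul_of_nonneg_left (hqF (U w)) (exp_pos (2 * w.re)).le
    simp only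
    linarith
  obtain ⟨C, hC0, hC⟩ := S.U_L1
  have hUi : Integrable U := S.Ucont.integrable_of_hasCompactSupport S.Ucompact
  set c := (2 - p) * (1 - δ) with hc
  -- the finite difference inequality
  have key : ∀ η > 0, ∀ᶠ τ in nhdsWithin (0:ℝ) (Set.Ioi 0),
      τ⁻¹ * (E / p * (1 - exp (-(c * τ)))) ≤ 2 * (1 + δ) * I + η * (exp (2 * δ) * C) := by
    intro η hη
    filter_upwards [S.uniform hη, self_mem_nhdsWithin] with τ hun hτ
    have hτ' : (0:ℝ) < τ := hτ
    have hτ0 : 0 ≤ τ := hτ'.le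
    have hcl := dil_compact S.Ucompact (one_le_exp' hτ0)
    have ifUl := S.weight_integrable (S.Udil_cont (exp τ)) hcl
    have iFl := F_integrable hFc hF0 (S.Udil_cont (exp τ)) hcl 2
    have idf : Integrable fun w => |U (exp τ • w) - U w| :=
      ((hUi.comp_smul (exp_pos τ).ne').sub hUi).abs
    have h1 := S.test_dil hτ0
    have h2 := S.F_dil hFc hF0 hFn hτ0
    have h3 := hC τ hτ0
    have h4 : (∫ w, exp (2 * w.re) * F (U (exp τ • w))) - (∫ w, exp (2 * w.re) * F (U w))
        - η * exp (2 * δ) * ∫ w, |U (exp τ • w) - U w| ≤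
        (∫ w, exp (2 * w.re) * f (U w) * U (exp τ • w))
        - ∫ w, exp (2 * w.re) * f (U w) * U w := by
      have i12 : Integrable fun w => exp (2 * w.re) * F (U (exp τ • w)) - exp (2 * w.re) * F (U w) :=
        iFl.sub iF
      rw [← integral_const_mul, ← integral_sub iFl iF, ← integral_sub i12
        (idf.const_mul _), ← integral_sub ifUl ifU]
      apply integral_mono (i12.sub (idf.const_mul _)) (ifUl.sub ifU)
      intro w
      simp only [Pi.sub_apply]
      by_cases hw : w ∈ Q
      · have ht := taylor hF (hun w hw)
        have hw2 : exp (2 * w.re) ≤ exp (2 * δ) := by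
          apply Real.exp_le_exp.2
          linarith [(abs_le.1 (S.Qre w hw)).2]
        have ht2 := mul_le_mul_of_nonneg_left ht (exp_pos (2 * w.re)).le
        have ht3 : exp (2 * w.re) * (η * |U (exp τ • w) - U w|) ≤
            exp (2 * δ) * (η * |U (exp τ • w) - U w|) := by
          gcongr
        linarith
      · have hw' : exp τ • w ∉ Q := fun h => hw (S.mem_of_smul (one_le_exp' hτ0) h)
        rw [S.Uzero _ hw, S.Uzero _ hw']
        simp [hF0]
    rw [← S.energy_eq] at h4
    have h5 : 1 - exp (-(2 * (1 + δ) * τ)) ≤ 2 * (1 + δ) * τ := one_sub_exp_neg _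
    have h6 : (1 - exp (-(2 * (1 + δ) * τ))) * I ≤ 2 * (1 + δ) * τ * I :=
      mul_le_mul_of_nonneg_right h5 hI0
    have h7 : η * exp (2 * δ) * ∫ w, |U (exp τ • w) - U w| ≤ η * exp (2 * δ) * (C * τ) := by
      gcongr
    rw [inv_mul_le_iff₀ hτ']
    have h8 : 1 / p * (exp (-(c * τ)) * E) + (1 - 1 / p) * E
        = E - E / p * (1 - exp (-(c * τ))) := by
      field_simp; ring
    rw [h8] at h1
    linarith
  have hlim : Filter.Tendsto (fun τ => τ⁻¹ * (E / p * (1 - exp (-(c * τ)))))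
      (nhdsWithin (0:ℝ) (Set.Ioi 0)) (nhds (E / p * c)) := by
    have hd : HasDerivAt (fun τ => E / p * (1 - exp (-(c * τ)))) (E / p * c) 0 := by
      have h1 : HasDerivAt (fun τ : ℝ => -(c * τ)) (-c) 0 := by
        have := ((hasDerivAt_id (0:ℝ)).const_mul c).neg
        rw [mul_one] at this
        exact this
      have h2 := (h1.exp.const_sub 1).const_mul (E / p)
      simpa using h2
    simpa using hd.tendsto_slope_zero_right
  have hfin : E / p * c ≤ 2 * (1 + δ) * I := by
    apply le_of_forall_pos_le_add
    intro e he
    have hpos : 0 < exp (2 * δ) * C + 1 := by positivity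
    have h1 := le_of_tendsto hlim (key (e / (exp (2 * δ) * C + 1)) (by positivity))
    refine h1.trans ?_
    gcongr
    rw [div_mul_eq_mul_div, div_le_iff₀ hpos]
    nlinarith
  have hI' : I ≤ E / q := by rw [le_div_iff₀ hq]; linarith
  by_contra hne
  have hEpos : 0 < E := lt_of_le_of_ne hE0 (Ne.symm hne)
  have h1 := mul_lt_mul_of_pos_left hcon hEpos
  have h2 : 2 * (1 + δ) * I ≤ 2 * (1 + δ) * (E / q) := by
    have := S.hδ
    gcongr
  have h3 : E * (2 * (1 + δ) / q) = 2 * (1 + δ) * (E / q) := by ring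
  have h4 : E * (c / p) = E / p * c := by ring
  linarith

lemma U_zero (S : Setup p δ R f Q U B) (hE : En p Q U = 0) (w : ℂ) : U w = 0 := by
  have hp0 : 0 < p := by linarith [S.hp1]
  have hae : ∀ᵐ w : ℂ, w ∈ Q → fderiv ℝ U w = 0 := by
    unfold En at hE
    rw [integral_eq_zero_iff_of_nonneg (fun w => by simp only [Pi.zero_apply]; positivity)
      S.Eint] at hE
    have := (ae_restrict_iff' S.Qopen.measurableSet).1 hE
    filter_upwards [this] with w hw hwQ
    have h1 := hw hwQ
    simp only [Pi.zero_apply, mul_eq_zero, (exp_pos _).ne', false_or] at h1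
    rw [Real.rpow_eq_zero (norm_nonneg _) hp0.ne'] at h1
    exact norm_eq_zero.1 h1
  have hV : ∀ n : ℕ, trunc (1 / ((n:ℝ) + 1)) (U w) = 0 := by
    intro n
    have hε : 0 < 1 / ((n:ℝ) + 1) := by positivity
    have hcd := S.V_contDiff hε
    have h0 : fderiv ℝ (fun w => trunc (1 / ((n:ℝ) + 1)) (U w)) = 0 := by
      rw [← Continuous.ae_eq_iff_eq (μ := volume) (hcd.continuous_fderiv one_ne_zero)
        continuous_zero]
      filter_upwards [hae] with y hy
      by_cases hyQ : y ∈ Q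
      · rw [S.V_fderiv _ hyQ, hy hyQ]; simp
      · rw [fderiv_off (S.V_tsupport hε) hyQ]; rfl
    have hconst := is_const_of_fderiv_eq_zero (𝕜 := ℝ) (hcd.differentiable one_ne_zero)
      (fun x => congrFun h0 x) w ((|R| + 1 : ℝ) : ℂ)
    rw [hconst, S.Uzero, trunc_eq_zero hε (by simpa using hε.le)]
    intro h
    have := S.Qbd _ h
    rw [Complex.norm_real, Real.norm_eq_abs, abs_of_pos (by positivity)] at this
    linarith [le_abs_self R]
  have h1 := trunc_tendsto (U w)
  simp_rw [hV] at h1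
  exact tendsto_nhds_unique h1 tendsto_const_nhds

end Setup


/-! ### Pulling the equation back to logarithmic coordinates -/

lemma norm_eq_of_apply {L : ℂ →L[ℝ] ℝ} {g : ℂ} (h : ∀ v, L v = g.re * v.re + g.im * v.im) :
    ‖L‖ = ‖g‖ := by
  have hL : ∀ v, L v = ((starRingEnd ℂ) g * v).re := by
    intro v; rw [h]; simp
  apply le_antisymm
  · apply L.opNorm_le_bound (norm_nonneg _)
    intro v
    rw [hL, Real.norm_eq_abs]
    refine (Complex.abs_re_le_norm _).trans ?_
    rw [norm_mul, RCLike.norm_conj]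
  · by_cases hg : g = 0
    · simp [hg]
    have h1 := L.le_opNorm g
    have h2 : L g = ‖g‖ * ‖g‖ := by
      rw [h, ← Complex.normSq_apply, Complex.normSq_eq_norm_sq, sq]
    rw [h2, norm_mul, norm_norm] at h1
    exact le_of_mul_le_mul_right h1 (norm_pos_iff.2 hg)

lemma fderiv_apply_grad (u : ℂ → ℝ) (z v : ℂ) :
    fderiv ℝ u z v = (grad u z).re * v.re + (grad u z).im * v.im := by
  have : v = v.re • (1:ℂ) + v.im • Complex.I := by
    apply Complex.ext <;> simp
  conv_lhs => rw [this, map_add, map_smul, map_smul]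
  simp only [grad, smul_eq_mul]
  ring

/-- The rectangle. -/
def Rect (a b α : ℝ) : Set ℂ := Set.Ioo a b ×ℂ Set.Ioo (-α) α

lemma mem_Rect {a b α : ℝ} {w : ℂ} :
    w ∈ Rect a b α ↔ (a < w.re ∧ w.re < b) ∧ (-α < w.im ∧ w.im < α) := by
  simp [Rect, Complex.mem_reProdIm]

lemma Rect_open (a b α : ℝ) : IsOpen (Rect a b α) := isOpen_Ioo.reProdIm isOpen_Ioo

lemma Rect_convex (a b α : ℝ) : Convex ℝ (Rect a b α) := by
  have h1 : Convex ℝ (Complex.reCLM ⁻¹' Set.Ioo a b) :=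
    (convex_Ioo a b).linear_preimage Complex.reCLM.toLinearMap
  have h2 : Convex ℝ (Complex.imCLM ⁻¹' Set.Ioo (-α) α) :=
    (convex_Ioo (-α) α).linear_preimage Complex.imCLM.toLinearMap
  exact h1.inter h2

lemma exp_image_Rect {α s : ℝ} (hs0 : 0 < s) (hs1 : s < 1) :
    Complex.exp '' Rect (log (1 - s)) (log (1 + s)) α = Omega2 α s := by
  ext z
  constructor
  · rintro ⟨w, hw, rfl⟩
    rw [mem_Rect] at hw
    refine ⟨exp w.re, w.im, abs_lt.2 hw.2, ?_, ?_⟩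
    · rw [abs_lt]
      have h1 := (Real.log_lt_iff_lt_exp (by linarith)).1 hw.1.1
      have h2 := (Real.lt_log_iff_exp_lt (by linarith)).1 hw.1.2
      constructor <;> linarith
    · rw [Complex.ofReal_exp, ← Complex.exp_add, Complex.re_add_im]
  · rintro ⟨ρ, θ, hθ, hρ, rfl⟩
    rw [abs_lt] at hθ hρ
    have hρ0 : 0 < ρ := by linarith
    refine ⟨(log ρ : ℂ) + θ * Complex.I, ?_, ?_⟩
    · rw [mem_Rect]
      simp only [Complex.add_re, Complex.ofReal_re, Complex.mul_re, Complex.I_re, mul_zero,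
        Complex.ofReal_im, Complex.I_im, mul_one, sub_self, add_zero, Complex.add_im,
        Complex.mul_im, zero_add]
      exact ⟨⟨Real.log_lt_log (by linarith) (by linarith),
        Real.log_lt_log hρ0 (by linarith)⟩, hθ⟩
    · rw [Complex.exp_add, ← Complex.ofReal_exp, Real.exp_log hρ0]

lemma closure_Rect_im {a b α : ℝ} {w : ℂ} (hw : w ∈ closure (Rect a b α)) : |w.im| ≤ α := by
  have h : IsClosed {w : ℂ | |w.im| ≤ α} :=
    isClosed_le (continuous_abs.comp Complex.continuous_im) continuous_const
  have hsub : Rect a b α ⊆ {w : ℂ | |w.im| ≤ α} := by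
    intro w hw
    rw [mem_Rect] at hw
    exact (abs_lt.2 hw.2).le
  exact closure_minimal hsub h hw

lemma exp_inj_strip {α : ℝ} (hα : α < π) {w w' : ℂ} (hw : |w.im| ≤ α) (hw' : |w'.im| ≤ α)
    (h : Complex.exp w = Complex.exp w') : w = w' := by
  rw [abs_le] at hw hw'
  exact Complex.exp_inj_of_neg_pi_lt_of_le_pi (by linarith) (by linarith) (by linarith)
    (by linarith) h

lemma det_mul_complex (e : ℂ) :
    ((ContinuousLinearMap.mul ℝ ℂ) e).det = ‖e‖ ^ 2 := by
  rw [← Complex.normSq_eq_norm_sq, ← Algebra.norm_complex_apply]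
  rfl

lemma hasFDerivAt_cexp_real (w : ℂ) :
    HasFDerivAt Complex.exp ((ContinuousLinearMap.mul ℝ ℂ) (Complex.exp w)) w := by
  have h := (Complex.hasDerivAt_exp w).hasFDerivAt.restrictScalars ℝ
  refine h.congr_fderiv ?_
  refine ContinuousLinearMap.ext fun v => ?_
  change v * Complex.exp w = Complex.exp w * v
  ring

/-- The pulled back field. -/
def pullB (A : ℂ → ℂ) (w : ℂ) : ℂ := (starRingEnd ℂ) (Complex.exp w) * A (Complex.exp w)

lemma divg_pullB {A : ℂ → ℂ} {w : ℂ} (hA : DifferentiableAt ℝ A (Complex.exp w)) :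
    divg (pullB A) w = ‖Complex.exp w‖ ^ 2 * divg A (Complex.exp w) := by
  have h1 := hasFDerivAt_cexp_real w
  have h2 : HasFDerivAt (fun w => (starRingEnd ℂ) (Complex.exp w))
      ((Complex.conjCLE : ℂ →L[ℝ] ℂ).comp ((ContinuousLinearMap.mul ℝ ℂ) (Complex.exp w))) w :=
    (Complex.conjCLE : ℂ →L[ℝ] ℂ).hasFDerivAt.comp w h1
  have h3 := hA.hasFDerivAt.comp w h1
  have h4 := h2.mul h3
  have h5 : fderiv ℝ (pullB A) w = _ := h4.fderiv
  have h6 : ∀ v, fderiv ℝ A (Complex.exp w) v =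
      v.re • fderiv ℝ A (Complex.exp w) 1 + v.im • fderiv ℝ A (Complex.exp w) Complex.I := by
    intro v
    have : v = v.re • (1:ℂ) + v.im • Complex.I := by
      apply Complex.ext <;> simp
    conv_lhs => rw [this, map_add, map_smul, map_smul]
  rw [divg, h5, divg, ← Complex.normSq_eq_norm_sq, Complex.normSq_apply]
  simp only [add_apply, smul_apply, ContinuousLinearMap.comp_apply,
    ContinuousLinearMap.mul_apply', smul_eq_mul, Function.comp]
  rw [h6 (Complex.exp w * 1), h6 (Complex.exp w * Complex.I)]
  simp
  ring

/-- The pulled back function. -/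
def pullU (Q : Set ℂ) (u : ℂ → ℝ) : ℂ → ℝ := Q.indicator (fun w => u (Complex.exp w))

lemma pullU_fderiv {Q : Set ℂ} (hQ : IsOpen Q) {u : ℂ → ℝ} {w : ℂ} (hw : w ∈ Q)
    (hu : DifferentiableAt ℝ u (Complex.exp w)) (v : ℂ) :
    fderiv ℝ (pullU Q u) w v =
      ((starRingEnd ℂ) (Complex.exp w) * grad u (Complex.exp w)).re * v.re +
      ((starRingEnd ℂ) (Complex.exp w) * grad u (Complex.exp w)).im * v.im := by
  have h1 : pullU Q u =ᶠ[nhds w] (fun w => u (Complex.exp w)) := by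
    filter_upwards [hQ.mem_nhds hw] with x hx
    exact Set.indicator_of_mem hx _
  have h2 : HasFDerivAt (fun w => u (Complex.exp w)) _ w :=
    hu.hasFDerivAt.comp w (hasFDerivAt_cexp_real w)
  rw [h1.fderiv_eq, h2.fderiv, ContinuousLinearMap.comp_apply, fderiv_apply_grad]
  simp only [ContinuousLinearMap.mul_apply', Complex.mul_re, Complex.mul_im, Complex.conj_re,
    Complex.conj_im]
  ring

lemma pullU_norm_fderiv {Q : Set ℂ} (hQ : IsOpen Q) {u : ℂ → ℝ} {w : ℂ} (hw : w ∈ Q)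
    (hu : DifferentiableAt ℝ u (Complex.exp w)) :
    ‖fderiv ℝ (pullU Q u) w‖ = exp w.re * ‖grad u (Complex.exp w)‖ := by
  rw [norm_eq_of_apply (pullU_fderiv hQ hw hu), norm_mul, RCLike.norm_conj, Complex.norm_exp]

lemma setup_pull {p δ α s : ℝ} (hp1 : 1 < p) (hp2 : p < 2) (hδ : 0 ≤ δ) {f : ℝ → ℝ}
    (hf : Continuous f) (hα0 : 0 < α) (hα : α < π) (hs0 : 0 < s) (hs1 : s < 1)
    (hl : -δ ≤ log (1 - s)) (hr : log (1 + s) ≤ δ) {u : ℂ → ℝ}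
    (hu : IsClassicalSolution p f (Omega2 α s) u) :
    Setup p δ (δ + α) f (Rect (log (1 - s)) (log (1 + s)) α)
      (pullU (Rect (log (1 - s)) (log (1 + s)) α) u)
      (pullB (fun z => (‖grad u z‖ ^ (p - 2) : ℝ) • grad u z)) := by
  have himg := exp_image_Rect (α := α) hs0 hs1
  set Q := Rect (log (1 - s)) (log (1 + s)) α with hQdef
  have hQo : IsOpen Q := Rect_open _ _ _
  have hΩo : IsOpen (Omega2 α s) := by
    rw [← himg]; exact Complex.isOpenMap_exp _ hQo
  have hmem : ∀ w ∈ Q, Complex.exp w ∈ Omega2 α s := fun w hw => by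
    rw [← himg]; exact Set.mem_image_of_mem _ hw
  have hud : ∀ w ∈ Q, DifferentiableAt ℝ u (Complex.exp w) := fun w hw =>
    (hu.contDiffOn.differentiableOn one_ne_zero).differentiableAt (hΩo.mem_nhds (hmem w hw))
  have hexpC : ContDiff ℝ 1 Complex.exp := (Complex.contDiff_exp (𝕜 := ℝ))
  have hQim : ∀ w ∈ Q, |w.im| ≤ α := fun w hw => closure_Rect_im (subset_closure hw)
  have hinj : Set.InjOn Complex.exp Q := fun w hw w' hw' h =>
    exp_inj_strip hα (hQim w hw) (hQim w' hw') h
  have hQre : ∀ w ∈ Q, |w.re| ≤ δ := by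
    intro w hw
    rw [hQdef, mem_Rect] at hw
    rw [abs_le]; constructor <;> linarith [hw.1.1, hw.1.2]
  have hclos : ∀ w ∈ closure Q, Complex.exp w ∈ closure (Omega2 α s) := by
    intro w hw
    rw [← himg]
    exact image_closure_subset_closure_image Complex.continuous_exp (Set.mem_image_of_mem _ hw)
  refine
    { hp1 := hp1, hp2 := hp2, hδ := hδ, hf := hf, Qopen := hQo, Qconv := Rect_convex _ _ _
      Qzero := ?_, Qbd := ?_, Qre := hQre, Ucont := ?_, Uzero := ?_, Udiff := ?_, Bdiff := ?_
      Bnorm := ?_, Bapp := ?_, Bdiv := ?_, Eint := ?_ }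
  · rw [hQdef, mem_Rect]
    refine ⟨⟨?_, ?_⟩, ?_, ?_⟩
    · exact Real.log_neg (by linarith) (by linarith)
    · exact Real.log_pos (by linarith)
    · simpa using hα0
    · simpa using hα0
  · intro w hw
    exact (Complex.norm_le_abs_re_add_abs_im w).trans (add_le_add (hQre w hw) (hQim w hw))
  · apply continuous_indicator
    · intro w hw
      apply hu.boundary
      rw [frontier, hQo.interior_eq] at hw
      rw [frontier, hΩo.interior_eq]
      refine ⟨hclos w hw.1, fun h => hw.2 ?_⟩
      rw [← himg] at h
      obtain ⟨w', hw', he⟩ := h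
      rw [← exp_inj_strip hα (hQim w' hw') (closure_Rect_im hw.1) he]
      exact hw'
    · exact hu.contOn.comp Complex.continuous_exp.continuousOn hclos
  · intro w hw
    exact Set.indicator_of_notMem hw _
  · have h : ContDiffOn ℝ 1 (fun w => u (Complex.exp w)) Q :=
      hu.contDiffOn.comp hexpC.contDiffOn hmem
    exact h.congr fun w hw => Set.indicator_of_mem hw _
  · have h1 : ContDiffOn ℝ 1 (fun w => (fun z => (‖grad u z‖ ^ (p - 2) : ℝ) • grad u z)
      (Complex.exp w)) Q := hu.fieldContDiffOn.comp hexpC.contDiffOn hmem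
    have h2 : ContDiff ℝ 1 (fun w => (starRingEnd ℂ) (Complex.exp w)) :=
      (Complex.conjCLE : ℂ →L[ℝ] ℂ).contDiff.comp hexpC
    exact h2.contDiffOn.mul h1
  · intro w hw
    rw [pullU_norm_fderiv hQo hw (hud w hw)]
    simp only [pullB]
    rw [norm_mul, RCLike.norm_conj, Complex.norm_exp, norm_smul, Real.norm_eq_abs,
      abs_of_nonneg (Real.rpow_nonneg (norm_nonneg _) _),
      Real.mul_rpow (exp_pos _).le (norm_nonneg _), ← Real.exp_mul,
      ← mul_assoc (exp ((2 - p) * w.re)), ← Real.exp_add]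
    have e1 : (2 - p) * w.re + w.re * (p - 1) = w.re := by ring
    rw [e1]
    congr 1
    rcases (norm_nonneg (grad u (Complex.exp w))).eq_or_lt with h | h
    · rw [← h, mul_zero, Real.zero_rpow (by linarith)]
    · rw [← Real.rpow_add_one h.ne']
      congr 1; ring
  · intro w hw
    rw [pullU_norm_fderiv hQo hw (hud w hw), pullU_fderiv hQo hw (hud w hw)]
    rw [Real.mul_rpow (exp_pos _).le (norm_nonneg _), ← Real.exp_mul, ← mul_assoc, ← Real.exp_add]
    have e1 : (2 - p) * w.re + w.re * p = w.re + w.re := by ring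
    rw [e1, Real.exp_add, ← Complex.norm_exp]
    simp only [pullB]
    generalize grad u (Complex.exp w) = g
    generalize Complex.exp w = e
    have e2 : ((starRingEnd ℂ) e * (‖g‖ ^ (p - 2) : ℝ) • g) =
      (‖g‖ ^ (p - 2) : ℝ) • ((starRingEnd ℂ) e * g) := by
      rw [mul_smul_comm]
    rw [e2, Complex.smul_re, Complex.smul_im, smul_eq_mul, smul_eq_mul]
    have e3 : ((starRingEnd ℂ) e * g).re * ((starRingEnd ℂ) e * g).re +
        ((starRingEnd ℂ) e * g).im * ((starRingEnd ℂ) e * g).im = ‖e‖ ^ 2 * ‖g‖ ^ 2 := by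
      rw [← Complex.normSq_apply, Complex.normSq_eq_norm_sq, norm_mul, RCLike.norm_conj]
      ring
    have e4 : ‖g‖ ^ p = ‖g‖ ^ (p - 2) * ‖g‖ ^ 2 := by
      rcases (norm_nonneg g).eq_or_lt with h | h
      · rw [← h, Real.zero_rpow (by linarith)]; simp
      · rw [← Real.rpow_natCast, ← Real.rpow_add h]
        congr 1; push_cast; ring
    rw [e4]
    linear_combination (‖g‖ ^ (p - 2)) * e3
  · intro w hw
    rw [divg_pullB]
    · have h1 := hu.pde _ (hmem w hw)
      have h2 : pullU Q u w = u (Complex.exp w) := Set.indicator_of_mem hw _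
      have h3 : exp (2 * w.re) = ‖Complex.exp w‖ ^ 2 := by
        rw [Complex.norm_exp, ← Real.exp_nat_mul]; norm_num
      rw [h2, h3]
      linear_combination (‖Complex.exp w‖ ^ 2) * h1
    · exact (hu.fieldContDiffOn.differentiableOn one_ne_zero).differentiableAt
        (hΩo.mem_nhds (hmem w hw))
  · have h := hu.integrable
    rw [← himg, integrableOn_image_iff_integrableOn_abs_det_fderiv_smul volume
      hQo.measurableSet (fun w _ => (hasFDerivAt_cexp_real w).hasFDerivWithinAt) hinj] at h
    refine h.congr_fun ?_ hQo.measurableSet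
    intro w hw
    simp only
    rw [pullU_norm_fderiv hQo hw (hud w hw), det_mul_complex, abs_of_nonneg (by positivity),
      Real.mul_rpow (exp_pos _).le (norm_nonneg _), ← Real.exp_mul, ← mul_assoc, ← Real.exp_add,
      Complex.norm_exp, smul_eq_mul, ← Real.exp_nat_mul]
    congr 2
    push_cast; ring
/-- Nonexistence of nontrivial solutions for supercritical problems in `Ω₂^{α,s}`,
for `s` small, uniformly in `α ∈ (0, π)`. -/
theorem nonexistence_general_f (p : ℝ) (hp1 : 1 < p) (hp2 : p < 2)
    (f F : ℝ → ℝ) (hf : Continuous f)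
    (hF : ∀ t : ℝ, F t = ∫ τ in (0:ℝ)..t, f τ)
    (q : ℝ) (hq : 2 * p / (2 - p) < q)
    (hqF : ∀ t : ℝ, q * F t ≤ t * f t ∧ 0 ≤ q * F t) :
    ∃ sbar : ℝ, sbar ∈ Set.Ioo (0:ℝ) 1 ∧
      ∀ α ∈ Set.Ioo (0:ℝ) π, ∀ s ∈ Set.Ioo (0:ℝ) sbar,
        ∀ u : ℂ → ℝ, IsClassicalSolution p f (Omega2 α s) u →
          ∀ z ∈ Omega2 α s, u z = 0 := by
  have h2p : 0 < 2 - p := by linarith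
  have hp0 : 0 < p := by linarith
  have hq0 : 0 < q := lt_trans (by positivity) hq
  have hab : 2 / q < (2 - p) / p := by
    rw [div_lt_div_iff₀ hq0 hp0]
    rw [div_lt_iff₀ h2p] at hq
    linarith
  set a := (2 - p) / p with ha
  set b := 2 / q with hb
  have hb0 : 0 < b := by positivity
  have ha0 : 0 < a := by positivity
  set δ := (a - b) / (2 * (a + b)) with hδ
  have hδ0 : 0 < δ := div_pos (by linarith) (by positivity)
  have hδe : δ * (2 * (a + b)) = a - b := by
    rw [hδ]; field_simp
  have hcon : 2 * (1 + δ) / q < (2 - p) * (1 - δ) / p := by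
    have e1 : 2 * (1 + δ) / q = b * (1 + δ) := by rw [hb]; ring
    have e2 : (2 - p) * (1 - δ) / p = a * (1 - δ) := by rw [ha]; ring
    rw [e1, e2]
    nlinarith
  have hFd : ∀ t, HasDerivAt F (f t) t := by
    intro t
    have h : F = fun t => ∫ τ in (0:ℝ)..t, f τ := funext hF
    rw [h]
    exact intervalIntegral.integral_hasDerivAt_right (hf.intervalIntegrable _ _)
      (hf.stronglyMeasurableAtFilter _ _) hf.continuousAt
  have hF0 : F 0 = 0 := by rw [hF]; simp
  have hFn : ∀ t, 0 ≤ F t := fun t => nonneg_of_mul_nonneg_right (hqF t).2 hq0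
  refine ⟨1 - exp (-δ), ⟨?_, ?_⟩, ?_⟩
  · have : exp (-δ) < 1 := by rw [← Real.exp_zero]; exact Real.exp_lt_exp.2 (by linarith)
    linarith
  · linarith [exp_pos (-δ)]
  intro α hα s hs u hu z hz
  have hs1 : s < 1 := by linarith [hs.2, exp_pos (-δ)]
  have hl : -δ ≤ log (1 - s) := by
    rw [Real.le_log_iff_exp_le (by linarith)]
    linarith [hs.2]
  have hr : log (1 + s) ≤ δ := by
    have h1 : log (1 - s) + log (1 + s) ≤ 0 := by
      rw [← Real.log_mul (by linarith) (by linarith [hs.1])]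
      apply Real.log_nonpos
      · nlinarith [hs.1]
      · nlinarith [hs.1]
    linarith
  have S := setup_pull hp1 hp2 hδ0.le hf hα.1 hα.2 hs.1 hs1 hl hr hu
  have hE := S.energy_zero hFd hF0 hFn hq0 (fun t => (hqF t).1) hcon
  rw [← exp_image_Rect hs.1 hs1] at hz
  obtain ⟨w, hw, rfl⟩ := hz
  have h := S.U_zero hE w
  rwa [pullU, Set.indicator_of_mem hw] at h
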